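/- arXiv:1207.7203 — 2 statements merged into one kernel-verified Lean document; each statement's English description precedes it below -/
import Mathlib

section
/- Let A be a densely defined closed operator on a Banach space X such that (0,∞) ⊆ ρ(A) and ‖λ(λ-A)^{-1}‖ ≤ C for all λ > 0. Suppose a family (T_α(t))_{t≥0} of bounded operators is strongly continuous with ‖T_α(t)‖ ≤ M t^α and (λ-A)^{-1}f = λ^α ∫₀^∞ e^{-λt} T_α(t) f dt for Re λ > 0. Then for f ∈ D(A) and 0 < σ < 1: (-A)^σ f = (Γ(σ+α+1)/(Γ(-σ)Γ(1+σ))) ∫₀^∞ (T_α(t)f - t^α f/Γ(α+1)) t^{-σ-α-1} dt, where (-A)^σ f = (sin(πσ)/π) ∫₀^∞ λ^{σ-1} (λ-A)^{-1}(-Af) dλ. -/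
open Real MeasureTheory Set Complex

lemma aux_int_exp {X : Type*} [NormedAddCommGroup X] [NormedSpace ℂ X]
    (f : ℝ → X) (K a : ℝ) (ha : -1 < a) (hc : ContinuousOn f (Ioi 0))
    (hb : ∀ t : ℝ, 0 < t → ‖f t‖ ≤ K * t ^ a) (z : ℂ) (hz : 0 < z.re) :
    IntegrableOn (fun t : ℝ => Complex.exp (-z * t) • f t) (Ioi 0) := by
  have h1 := (integrableOn_rpow_mul_exp_neg_mul_rpow ha one_pos hz).const_mul K
  refine Integrable.mono' h1 ?_ ?_
  · refine ContinuousOn.aestronglyMeasurable ?_ measurableSet_Ioi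
    exact ContinuousOn.smul (by fun_prop) hc
  · filter_upwards [ae_restrict_mem measurableSet_Ioi] with t ht
    have ht : 0 < t := ht
    rw [norm_smul, Complex.norm_exp, Real.rpow_one]
    simp only [Complex.mul_re, Complex.neg_re, Complex.ofReal_re, Complex.ofReal_im, mul_zero, sub_zero]
    calc _ ≤ rexp (-z.re * t) * (K * t ^ a) := by gcongr; exact hb t ht
      _ = _ := by ring

lemma aux_uniq {X : Type*} [NormedAddCommGroup X] [NormedSpace ℂ X] [CompleteSpace X]
    (u : ℝ → X) (hc : ContinuousOn u (Ioi 0))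
    (hi : IntegrableOn (fun t : ℝ => Complex.exp (-(1:ℂ) * t) • u t) (Ioi 0))
    (h0 : ∀ z : ℂ, 0 < z.re → ∫ t in Ioi (0:ℝ), Complex.exp (-z * t) • u t = 0)
    (t : ℝ) (ht : 0 < t) : u t = 0 := by
  set F : ℝ → X := (Ioi (0:ℝ)).indicator (fun t : ℝ => Complex.exp (-(1:ℂ) * t) • u t) with hF
  have hFi : Integrable F := hi.integrable_indicator measurableSet_Ioi
  have hFF : FourierTransform.fourier F = 0 := by
    ext w
    rw [Real.fourier_real_eq_integral_exp_smul]
    have := h0 (1 + (2 * π * w : ℝ) * Complex.I) (by simp)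
    rw [← integral_indicator measurableSet_Ioi] at this
    rw [Pi.zero_apply, ← this]
    congr 1
    ext v
    by_cases hv : v ∈ Ioi (0:ℝ)
    · rw [hF, indicator_of_mem hv, indicator_of_mem hv, smul_smul, ← Complex.exp_add]
      congr 2
      push_cast
      ring
    · rw [hF, indicator_of_notMem hv, indicator_of_notMem hv, smul_zero]
  have hct : ContinuousAt F t := by
    have : ContinuousAt (fun t : ℝ => Complex.exp (-(1:ℂ) * t) • u t) t :=
      ContinuousAt.smul (by fun_prop) (hc.continuousAt (Ioi_mem_nhds ht))
    refine this.congr ?_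
    filter_upwards [Ioi_mem_nhds ht] with s hs
    rw [hF, indicator_of_mem hs]
  have := hFi.fourierInv_fourier_eq (by rw [hFF]; exact integrable_zero _ _ _) hct
  rw [hFF] at this
  have h2 : F t = 0 := by
    rw [← this, Real.fourierInv_eq]; simp
  rw [hF, indicator_of_mem (show t ∈ Ioi 0 from ht)] at h2
  simpa using h2

lemma aux_gamma (α : ℝ) (hα : 0 ≤ α) (z : ℂ) (hz : 0 < z.re) :
    ∫ t in Ioi (0:ℝ), Complex.exp (-z * t) * ((t ^ α : ℝ) : ℂ) =
      z ^ (-(α + 1 : ℂ)) * (Real.Gamma (α + 1) : ℂ) := by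
  set U : Set ℂ := {z | 0 < z.re} with hU
  have hUo : IsOpen U := isOpen_lt continuous_const Complex.continuous_re
  have hcon : ∀ a : ℝ, 0 ≤ a → Continuous (fun t : ℝ => ((t ^ a : ℝ) : ℂ)) := fun a ha =>
    Complex.continuous_ofReal.comp (Real.continuous_rpow_const ha)
  have hint : ∀ a : ℝ, 0 ≤ a → ∀ w : ℂ, 0 < w.re →
      IntegrableOn (fun t : ℝ => Complex.exp (-w * t) * ((t ^ a : ℝ) : ℂ)) (Ioi 0) := by
    intro a ha w hw
    refine aux_int_exp (fun t : ℝ => ((t ^ a : ℝ) : ℂ)) 1 a (by linarith) (hcon a ha).continuousOn ?_ w hw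
    intro t ht
    rw [Complex.norm_real, Real.norm_of_nonneg (by positivity), one_mul]
  have hd1 : DifferentiableOn ℂ (fun w : ℂ => ∫ t in Ioi (0:ℝ), Complex.exp (-w * t) * ((t ^ α : ℝ) : ℂ)) U := by
    intro w hw
    have hw : 0 < w.re := hw
    refine DifferentiableAt.differentiableWithinAt ?_
    refine (hasDerivAt_integral_of_dominated_loc_of_deriv_le (μ := volume.restrict (Ioi (0:ℝ)))
      (F := fun (w : ℂ) (t : ℝ) => Complex.exp (-w * t) * ((t ^ α : ℝ) : ℂ))
      (F' := fun (w : ℂ) (t : ℝ) => (Complex.exp (-w * t) * (-t)) * ((t ^ α : ℝ) : ℂ))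
      (bound := fun t : ℝ => t ^ (α + 1) * rexp (- (w.re / 2) * t ^ (1:ℝ)))
      (s := {v : ℂ | w.re / 2 < v.re})
      ?_ ?_ (hint α hα w hw) ?_ ?_ ?_ ?_).2.differentiableAt
    · exact (isOpen_lt continuous_const Complex.continuous_re).mem_nhds (by simp; linarith)
    · refine Filter.Eventually.of_forall fun v => ?_
      refine ContinuousOn.aestronglyMeasurable ?_ measurableSet_Ioi
      exact ContinuousOn.mul (by fun_prop) (hcon α hα).continuousOn
    · refine ContinuousOn.aestronglyMeasurable ?_ measurableSet_Ioi
      exact ContinuousOn.mul (by fun_prop) (hcon α hα).continuousOn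
    · filter_upwards [ae_restrict_mem measurableSet_Ioi] with t ht v hv
      have ht : 0 < t := ht
      have hv : w.re / 2 < v.re := hv
      rw [norm_mul, norm_mul, Complex.norm_exp, Real.rpow_one, norm_neg, Complex.norm_real,
        Complex.norm_real, Real.norm_of_nonneg ht.le, Real.norm_of_nonneg (by positivity),
        Real.rpow_add_one ht.ne']
      simp only [Complex.mul_re, Complex.neg_re, Complex.ofReal_re, Complex.ofReal_im, mul_zero, sub_zero]
      have : rexp (-v.re * t) ≤ rexp (-(w.re/2) * t) := by
        apply Real.exp_le_exp.2; nlinarith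
      calc _ ≤ rexp (-(w.re/2) * t) * t * t ^ α := by gcongr
        _ = _ := by ring
    · exact integrableOn_rpow_mul_exp_neg_mul_rpow (by linarith) one_pos (by linarith)
    · refine Filter.Eventually.of_forall fun t v _ => ?_
      refine HasDerivAt.mul_const ?_ _
      have : HasDerivAt (fun v : ℂ => -v * (t:ℂ)) (-t) v := by
        simpa using ((hasDerivAt_id v).neg.mul_const (t:ℂ))
      exact this.cexp
  have hd2 : DifferentiableOn ℂ (fun w : ℂ => w ^ (-(α + 1 : ℂ)) * (Real.Gamma (α + 1) : ℂ)) U := by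
    intro w hw
    refine DifferentiableAt.differentiableWithinAt ?_
    refine DifferentiableAt.mul_const ?_ _
    exact DifferentiableAt.cpow (by fun_prop) (by fun_prop) (Or.inl hw)
  have hreal : ∀ r : ℝ, 0 < r → ∫ t in Ioi (0:ℝ), Complex.exp (-(r:ℂ) * t) * ((t ^ α : ℝ) : ℂ) =
      (r:ℂ) ^ (-(α + 1 : ℂ)) * (Real.Gamma (α + 1) : ℂ) := by
    intro r hr
    have h := Real.integral_rpow_mul_exp_neg_mul_Ioi (a := α + 1) (by linarith) hr
    have h2 : (((1 / r) ^ (α + 1) * Real.Gamma (α + 1) : ℝ) : ℂ) =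
        (r:ℂ) ^ (-(α + 1 : ℂ)) * (Real.Gamma (α + 1) : ℂ) := by
      rw [one_div, Real.inv_rpow hr.le, ← Real.rpow_neg hr.le]
      push_cast [Complex.ofReal_cpow hr.le]
      rfl
    rw [← h2, ← h, ← integral_complex_ofReal]
    congr 1
    ext t
    push_cast
    rw [add_sub_cancel_right, mul_comm, neg_mul]
  have hpre : IsPreconnected U := (convex_halfSpace_re_gt 0).isPreconnected
  refine (hd1.analyticOnNhd hUo).eqOn_of_preconnected_of_frequently_eq (hd2.analyticOnNhd hUo) hpre
    (z₀ := 1) (by simp [hU]) ?_ hz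
  have ht : Filter.Tendsto (fun x : ℝ => (x : ℂ)) (nhdsWithin 1 (Ioi 1)) (nhdsWithin 1 {1}ᶜ) := by
    refine tendsto_nhdsWithin_iff.2 ⟨?_, ?_⟩
    · have : Continuous (fun x : ℝ => (x:ℂ)) := Complex.continuous_ofReal
      simpa using (this.tendsto 1).mono_left nhdsWithin_le_nhds
    · filter_upwards [self_mem_nhdsWithin] with x hx
      have : (1:ℝ) < x := hx
      simp; exact_mod_cast this.ne'
  refine ht.frequently (Filter.Eventually.frequently ?_)
  filter_upwards [self_mem_nhdsWithin] with x hx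
  exact hreal x (lt_trans one_pos hx)

lemma aux_S {X : Type*} [NormedAddCommGroup X] [NormedSpace ℂ X] [CompleteSpace X]
    (v : ℝ → X) (K a : ℝ) (ha : 0 ≤ a) (hv : ContinuousOn v (Ici 0))
    (hb : ∀ t : ℝ, 0 ≤ t → ‖v t‖ ≤ K * t ^ a) :
    (∀ t : ℝ, 0 < t → HasDerivAt (fun t => ∫ s in (0:ℝ)..t, v s) (v t) t) ∧
    (∀ t : ℝ, 0 ≤ t → ‖∫ s in (0:ℝ)..t, v s‖ ≤ K * t ^ (a + 1)) := by
  have hK : 0 ≤ K := by have := (norm_nonneg _).trans (hb 1 zero_le_one); simpa using this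
  constructor
  · intro t ht
    refine intervalIntegral.integral_hasDerivAt_right ?_ ?_ (hv.continuousAt (Ici_mem_nhds ht))
    · exact (hv.mono (by rw [uIcc_of_le ht.le]; exact Icc_subset_Ici_self)).intervalIntegrable
    · exact (hv.mono Ioi_subset_Ici_self).stronglyMeasurableAtFilter isOpen_Ioi t ht
  · intro t ht
    have := intervalIntegral.norm_integral_le_of_norm_le_const (a := 0) (b := t) (f := v) (C := K * t ^ a) ?_
    · rcases ht.eq_or_lt with rfl | ht'
      · simp; positivity
      · rw [sub_zero, abs_of_pos ht'] at this
        rw [Real.rpow_add_one ht'.ne', ← mul_assoc]; exact this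
    · intro x hx
      rw [uIoc_of_le ht] at hx
      refine (hb x hx.1.le).trans ?_
      gcongr
      · exact hx.1.le
      · exact hx.2

lemma aux_ibp {X : Type*} [NormedAddCommGroup X] [NormedSpace ℂ X] [CompleteSpace X]
    (v : ℝ → X) (K a : ℝ) (ha : 0 ≤ a) (hv : ContinuousOn v (Ici 0))
    (hb : ∀ t : ℝ, 0 ≤ t → ‖v t‖ ≤ K * t ^ a) (z : ℂ) (hz : 0 < z.re) :
    ∫ t in Ioi (0:ℝ), Complex.exp (-z * t) • v t =
      z • ∫ t in Ioi (0:ℝ), Complex.exp (-z * t) • ∫ s in (0:ℝ)..t, v s := by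
  obtain ⟨hd, hB⟩ := aux_S v K a ha hv hb
  have hi1 := aux_int_exp v K a (by linarith) (hv.mono Ioi_subset_Ici_self) (fun t ht => hb t ht.le) z hz
  have hi2 := aux_int_exp (fun t => ∫ s in (0:ℝ)..t, v s) K (a+1) (by linarith)
    (fun t ht => (hd t ht).continuousAt.continuousWithinAt) (fun t ht => hB t ht.le) z hz
  have hnorm : ∀ t : ℝ, 0 ≤ t → ‖Complex.exp (-z * t) • ∫ s in (0:ℝ)..t, v s‖ ≤
      K * (t ^ (a+1) * rexp (-z.re * t)) := by
    intro t ht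
    rw [norm_smul, Complex.norm_exp]
    simp only [Complex.mul_re, Complex.neg_re, Complex.ofReal_re, Complex.ofReal_im, mul_zero, sub_zero]
    calc _ ≤ rexp (-z.re * t) * (K * t ^ (a+1)) := by gcongr; exact hB t ht
      _ = _ := by ring
  have key := integral_Ioi_of_hasDerivAt_of_tendsto (a := (0:ℝ)) (m := (0:X))
    (f := fun t : ℝ => Complex.exp (-z * t) • ∫ s in (0:ℝ)..t, v s)
    (f' := fun t : ℝ => Complex.exp (-z * t) • v t - z • (Complex.exp (-z * t) • ∫ s in (0:ℝ)..t, v s))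
    ?_ ?_ ?_ ?_
  · have hi3 : IntegrableOn (fun t : ℝ => z • (Complex.exp (-z * t) • ∫ s in (0:ℝ)..t, v s)) (Ioi 0) := hi2.smul z
    rw [integral_sub hi1 hi3, integral_smul] at key
    simpa [sub_eq_zero] using key
  · rw [ContinuousWithinAt]
    simp only [intervalIntegral.integral_same, smul_zero]
    refine squeeze_zero_norm' (a := fun t : ℝ => K * (t ^ (a+1) * rexp (-z.re * t))) ?_ ?_
    · filter_upwards [self_mem_nhdsWithin] with t ht using hnorm t ht
    · have : Continuous (fun t : ℝ => K * (t ^ (a+1) * rexp (-z.re * t))) :=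
        continuous_const.mul ((Real.continuous_rpow_const (by linarith)).mul (by fun_prop))
      have h := (this.tendsto 0).mono_left (nhdsWithin_le_nhds (s := Ici 0))
      simpa [Real.zero_rpow (show a + 1 ≠ 0 by linarith)] using h
  · intro t ht
    have h1 : HasDerivAt (fun t : ℝ => Complex.exp (-z * t)) (Complex.exp (-z * t) * (-z)) t := by
      have : HasDerivAt (fun t : ℝ => -z * (t:ℂ)) (-z) t := by
        simpa using (Complex.ofRealCLM.hasDerivAt (x := t)).const_mul (-z)
      exact this.cexp
    refine HasDerivAt.congr_deriv (f' := Complex.exp (-z * t) • v t + (Complex.exp (-z * t) * (-z)) • ∫ s in (0:ℝ)..t, v s) (h1.smul (hd t ht)) ?_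
    rw [smul_smul, sub_eq_add_neg, ← neg_smul]
    congr 2
    ring
  · exact hi1.sub (hi2.smul z)
  · refine squeeze_zero_norm' (a := fun t : ℝ => K * (t ^ (a+1) * rexp (-z.re * t))) ?_ ?_
    · filter_upwards [Filter.eventually_ge_atTop 0] with t ht using hnorm t ht
    · simpa using (tendsto_rpow_mul_exp_neg_mul_atTop_nhds_zero (a+1) z.re hz).const_mul K

lemma aux_fub {X : Type*} [NormedAddCommGroup X] [NormedSpace ℂ X] [CompleteSpace X]
    (h : ℝ → X) (K L α σ : ℝ) (hα : 0 ≤ α) (hσ0 : 0 < σ) (hσ1 : σ < 1)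
    (hc : ContinuousOn h (Ioi 0))
    (hb1 : ∀ t : ℝ, 0 < t → ‖h t‖ ≤ K * t ^ (α + 1))
    (hb2 : ∀ t : ℝ, 0 < t → ‖h t‖ ≤ L * t ^ α) :
    ∫ r in Ioi (0:ℝ), r ^ (σ + α) • ∫ t in Ioi (0:ℝ), Complex.exp (-(r:ℂ) * t) • h t =
      Real.Gamma (σ + α + 1) • ∫ t in Ioi (0:ℝ), t ^ (-σ - α - 1) • h t := by
  have hcp : ContinuousOn (fun t : ℝ => t ^ (-σ - α - 1) • h t) (Ioi 0) := by
    have h1 : ContinuousOn (fun t : ℝ => t ^ (-σ - α - 1)) (Ioi 0) :=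
      fun t ht => (Real.continuousAt_rpow_const t _ (Or.inl (ne_of_gt ht))).continuousWithinAt
    exact h1.smul hc
  have hI : IntegrableOn (fun t : ℝ => t ^ (-σ - α - 1) • h t) (Ioi 0) := by
    rw [← Ioc_union_Ioi_eq_Ioi (zero_le_one (α := ℝ))]
    refine IntegrableOn.union ?_ ?_
    · have h1 : IntegrableOn (fun t : ℝ => K * t ^ (-σ)) (Ioc 0 1) :=
        ((intervalIntegrable_iff_integrableOn_Ioc_of_le zero_le_one).1
          (intervalIntegral.intervalIntegrable_rpow' (by linarith))).const_mul K
      refine Integrable.mono' h1 ((hcp.mono Ioc_subset_Ioi_self).aestronglyMeasurable measurableSet_Ioc) ?_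
      filter_upwards [ae_restrict_mem measurableSet_Ioc] with t ht
      have ht : 0 < t := ht.1
      rw [norm_smul, Real.norm_of_nonneg (by positivity)]
      calc _ ≤ t ^ (-σ - α - 1) * (K * t ^ (α + 1)) := by gcongr; exact hb1 t ht
        _ = K * (t ^ (-σ - α - 1) * t ^ (α + 1)) := by ring
        _ = _ := by rw [← Real.rpow_add ht]; congr 2; ring
    · have h1 : IntegrableOn (fun t : ℝ => L * t ^ (-σ - 1)) (Ioi 1) :=
        (integrableOn_Ioi_rpow_of_lt (by linarith) one_pos).const_mul L
      refine Integrable.mono' h1 ((hcp.mono (Ioi_subset_Ioi zero_le_one)).aestronglyMeasurable measurableSet_Ioi) ?_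
      filter_upwards [ae_restrict_mem measurableSet_Ioi] with t ht
      have ht : 0 < t := lt_trans one_pos ht
      rw [norm_smul, Real.norm_of_nonneg (by positivity)]
      calc _ ≤ t ^ (-σ - α - 1) * (L * t ^ α) := by gcongr; exact hb2 t ht
        _ = L * (t ^ (-σ - α - 1) * t ^ α) := by ring
        _ = _ := by rw [← Real.rpow_add ht]; congr 2; ring
  have hG : ∀ t : ℝ, 0 < t → ∫ r in Ioi (0:ℝ), r ^ (σ + α) * rexp (-(t * r)) =
      Real.Gamma (σ + α + 1) * t ^ (-σ - α - 1) := by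
    intro t ht
    have := Real.integral_rpow_mul_exp_neg_mul_Ioi (a := σ + α + 1) (by linarith) ht
    rw [add_sub_cancel_right] at this
    rw [this, one_div, Real.inv_rpow ht.le, ← Real.rpow_neg ht.le, mul_comm]
    congr 2; ring
  have hGi : ∀ t : ℝ, 0 < t → IntegrableOn (fun r : ℝ => r ^ (σ + α) * rexp (-(t * r))) (Ioi 0) := by
    intro t ht
    simpa using integrableOn_rpow_mul_exp_neg_mul_rpow (s := σ + α) (p := 1) (b := t) (by linarith) one_pos ht
  set k : ℝ → ℝ → X := fun r t => (r ^ (σ + α) * rexp (-(t * r))) • h t with hk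
  have hkm : AEStronglyMeasurable (Function.uncurry k)
      ((volume.restrict (Ioi (0:ℝ))).prod (volume.restrict (Ioi (0:ℝ)))) := by
    rw [Measure.prod_restrict]
    refine ContinuousOn.aestronglyMeasurable ?_ (measurableSet_Ioi.prod measurableSet_Ioi)
    have h1 : Continuous (fun p : ℝ × ℝ => p.1 ^ (σ + α) * rexp (-(p.2 * p.1))) :=
      ((Real.continuous_rpow_const (by linarith)).comp continuous_fst).mul (by fun_prop)
    exact h1.continuousOn.smul (hc.comp continuousOn_snd (fun p hp => hp.2))
  have hki : Integrable (Function.uncurry k)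
      ((volume.restrict (Ioi (0:ℝ))).prod (volume.restrict (Ioi (0:ℝ)))) := by
    rw [integrable_prod_iff' hkm]
    constructor
    · filter_upwards [ae_restrict_mem measurableSet_Ioi] with t ht
      exact (hGi t ht).smul_const (h t)
    · refine (hI.norm.const_mul (Real.Gamma (σ + α + 1))).congr ?_
      filter_upwards [ae_restrict_mem measurableSet_Ioi] with t ht
      have ht : 0 < t := ht
      have : ∀ r ∈ Ioi (0:ℝ), ‖Function.uncurry k (r, t)‖ = (r ^ (σ + α) * rexp (-(t * r))) * ‖h t‖ := by
        intro r hr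
        have hr : 0 < r := hr
        simp only [Function.uncurry, hk]
        rw [norm_smul, Real.norm_of_nonneg (by positivity)]
      rw [setIntegral_congr_fun measurableSet_Ioi this, integral_mul_const, hG t ht, norm_smul,
        Real.norm_of_nonneg (by positivity), mul_assoc]
  have hsw := integral_integral_swap hki
  have e1 : ∀ r ∈ Ioi (0:ℝ), r ^ (σ + α) • ∫ t in Ioi (0:ℝ), Complex.exp (-(r:ℂ) * t) • h t =
      ∫ t in Ioi (0:ℝ), k r t := by
    intro r hr
    rw [← integral_smul]
    congr 1
    ext t
    simp only [hk]
    rw [mul_smul]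
    congr 1
    rw [← Complex.coe_smul]
    congr 1
    push_cast
    congr 1
    ring
  have e2 : ∀ t ∈ Ioi (0:ℝ), ∫ r in Ioi (0:ℝ), k r t = Real.Gamma (σ + α + 1) • (t ^ (-σ - α - 1) • h t) := by
    intro t ht
    simp only [hk]
    rw [integral_smul_const, hG t ht, mul_smul]
  rw [setIntegral_congr_fun measurableSet_Ioi e1, hsw, setIntegral_congr_fun measurableSet_Ioi e2, integral_smul]

theorem balakrishnan_via_integrated_semigroup
    {X : Type*} [NormedAddCommGroup X] [NormedSpace ℂ X] [CompleteSpace X]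
    (D : Submodule ℂ X) (hdense : Dense (D : Set X))
    (A : D →ₗ[ℂ] X)
    (hclosed : IsClosed {p : X × X | ∃ hp : p.1 ∈ D, A ⟨p.1, hp⟩ = p.2})
    (R : ℂ → X →L[ℂ] X) (C : ℝ)
    -- R λ is a two-sided inverse of (λ - A) for Re λ > 0
    (hRinv : ∀ lam : ℂ, 0 < lam.re →
      (∀ f : X, ∃ hf : R lam f ∈ D, lam • R lam f - A ⟨R lam f, hf⟩ = f) ∧
      (∀ g : D, R lam (lam • (g : X) - A g) = (g : X)))
    (hRbound : ∀ lam : ℝ, 0 < lam → ‖(lam : ℂ) • R lam‖ ≤ C)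
    (α : ℝ) (hα : 0 ≤ α)
    (T : ℝ → X →L[ℂ] X) (M : ℝ)
    (hTbound : ∀ t : ℝ, 0 ≤ t → ‖T t‖ ≤ M * t ^ α)
    (hTcont : ∀ f : X, ContinuousOn (fun t => T t f) (Ici (0:ℝ)))
    (hLaplace : ∀ lam : ℂ, 0 < lam.re → ∀ f : X,
      R lam f = lam ^ (α : ℂ) • ∫ t in Ioi (0:ℝ), Complex.exp (-lam * t) • T t f)
    (σ : ℝ) (hσ0 : 0 < σ) (hσ1 : σ < 1) (g : D) :
    (Real.sin (π * σ) / π) •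
        ∫ lam in Ioi (0:ℝ), lam ^ (σ - 1) • R (lam : ℂ) (-(A g)) =
      (Real.Gamma (σ + α + 1) / ((-Real.Gamma (1 - σ) / σ) * Real.Gamma (1 + σ))) •
        ∫ t in Ioi (0:ℝ),
          t ^ (-σ - α - 1) • (T t (g : X) - (t ^ α / Real.Gamma (α + 1)) • (g : X)) := by
  have hbnd : ∀ x : X, ∀ t : ℝ, 0 ≤ t → ‖T t x‖ ≤ (M * ‖x‖) * t ^ α := by
    intro x t ht
    calc ‖T t x‖ ≤ ‖T t‖ * ‖x‖ := (T t).le_opNorm x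
      _ ≤ (M * t ^ α) * ‖x‖ := by gcongr; exact hTbound t ht
      _ = _ := by ring
  have hΓ : 0 < Real.Gamma (α + 1) := Real.Gamma_pos_of_pos (by linarith)
  have hcα : Continuous (fun t : ℝ => t ^ α) := Real.continuous_rpow_const hα
  set h : ℝ → X := fun t => T t (g : X) - (t ^ α / Real.Gamma (α + 1)) • (g : X) with hh
  have hhc : ContinuousOn h (Ici 0) :=
    (hTcont g).sub ((hcα.div_const _).smul continuous_const).continuousOn
  have hhc' : ContinuousOn h (Ioi 0) := hhc.mono Ioi_subset_Ici_self
  have hb2 : ∀ t : ℝ, 0 < t → ‖h t‖ ≤ (M * ‖(g:X)‖ + ‖(g:X)‖ / Real.Gamma (α + 1)) * t ^ α := by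
    intro t ht
    calc ‖h t‖ ≤ ‖T t (g:X)‖ + ‖(t ^ α / Real.Gamma (α + 1)) • (g : X)‖ := norm_sub_le _ _
      _ ≤ (M * ‖(g:X)‖) * t ^ α + (t ^ α / Real.Gamma (α + 1)) * ‖(g:X)‖ := by
        gcongr
        · exact hbnd g t ht.le
        · rw [norm_smul, Real.norm_of_nonneg (by positivity)]
      _ = _ := by ring
  -- Laplace transform of h
  have hLh : ∀ z : ℂ, 0 < z.re → ∫ t in Ioi (0:ℝ), Complex.exp (-z * t) • h t =
      z⁻¹ • ∫ t in Ioi (0:ℝ), Complex.exp (-z * t) • T t (A g) := by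
    intro z hz
    have hz0 : z ≠ 0 := by rintro rfl; simp at hz
    have hi1 := aux_int_exp (fun t => T t (g:X)) (M * ‖(g:X)‖) α (by linarith)
      ((hTcont g).mono Ioi_subset_Ici_self) (fun t ht => hbnd g t ht.le) z hz
    have hi2 := aux_int_exp (fun t : ℝ => ((t ^ α : ℝ) : ℂ)) 1 α (by linarith)
      (Complex.continuous_ofReal.comp hcα).continuousOn
      (fun t ht => by rw [Complex.norm_real, Real.norm_of_nonneg (by positivity), one_mul]) z hz
    have hi3 := (hi2.div_const (Real.Gamma (α + 1) : ℂ)).smul_const (g : X)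
    have e : ∀ t : ℝ, Complex.exp (-z * t) • h t = Complex.exp (-z * t) • T t (g:X) -
        (Complex.exp (-z * t) • ((t ^ α : ℝ) : ℂ) / (Real.Gamma (α + 1) : ℂ)) • (g : X) := by
      intro t
      simp only [hh]
      rw [smul_sub, ← Complex.coe_smul, smul_smul, smul_eq_mul, mul_div_assoc]
      push_cast
      rfl
    simp_rw [e]
    rw [integral_sub hi1 hi3, integral_smul_const, integral_div]
    simp_rw [smul_eq_mul]
    rw [aux_gamma α hα z hz]
    have hΓ' : (Real.Gamma (α + 1) : ℂ) ≠ 0 := by exact_mod_cast hΓ.ne'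
    rw [mul_div_cancel_right₀ _ hΓ']
    have hR := (hRinv z hz).2 g
    rw [map_sub, map_smul, hLaplace z hz g, hLaplace z hz (A g)] at hR
    set P := ∫ t in Ioi (0:ℝ), Complex.exp (-z * t) • T t (g : X)
    set Q := ∫ t in Ioi (0:ℝ), Complex.exp (-z * t) • T t (A g)
    have hza : z ^ (α:ℂ) ≠ 0 := by simp [Complex.cpow_eq_zero_iff, hz0]
    rw [← hR, Complex.cpow_neg, Complex.cpow_add _ _ hz0, Complex.cpow_one, smul_sub,
      smul_smul, smul_smul, smul_smul]
    rw [show (z ^ (α:ℂ) * z)⁻¹ * z * z ^ (α:ℂ) = 1 by field_simp,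
      show (z ^ (α:ℂ) * z)⁻¹ * z ^ (α:ℂ) = z⁻¹ by field_simp, one_smul]
    abel
  -- h equals the integrated family applied to A g
  obtain ⟨hd, hB⟩ := aux_S (fun t => T t (A g)) (M * ‖A g‖) α hα (hTcont (A g)) (hbnd (A g))
  have hSc : ContinuousOn (fun t => ∫ s in (0:ℝ)..t, T s (A g)) (Ioi 0) :=
    fun t ht => (hd t ht).continuousAt.continuousWithinAt
  have hih := fun z hz => aux_int_exp h _ α (by linarith) hhc' hb2 z hz
  have hiS := fun z hz => aux_int_exp (fun t => ∫ s in (0:ℝ)..t, T s (A g)) _ (α + 1) (by linarith) hSc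
    (fun t ht => hB t ht.le) z hz
  have hS : ∀ t : ℝ, 0 < t → h t = ∫ s in (0:ℝ)..t, T s (A g) := by
    intro t ht
    refine sub_eq_zero.1 (aux_uniq (fun t => h t - ∫ s in (0:ℝ)..t, T s (A g)) (hhc'.sub hSc) ?_ ?_ t ht)
    · simp_rw [smul_sub]
      exact (hih 1 (by simp)).sub (hiS 1 (by simp))
    · intro z hz
      have hz0 : z ≠ 0 := by rintro rfl; simp at hz
      simp_rw [smul_sub]
      rw [integral_sub (hih z hz) (hiS z hz), hLh z hz,
        aux_ibp (fun t => T t (A g)) (M * ‖A g‖) α hα (hTcont (A g)) (hbnd (A g)) z hz,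
        smul_smul, inv_mul_cancel₀ hz0, one_smul, sub_self]
  have hb1 : ∀ t : ℝ, 0 < t → ‖h t‖ ≤ (M * ‖A g‖) * t ^ (α + 1) := by
    intro t ht
    rw [hS t ht]; exact hB t ht.le
  have hF := aux_fub h _ _ α σ hα hσ0 hσ1 hhc' hb1 hb2
  have e : ∀ r ∈ Ioi (0:ℝ), r ^ (σ - 1) • R (r : ℂ) (-(A g)) =
      -(r ^ (σ + α) • ∫ t in Ioi (0:ℝ), Complex.exp (-(r:ℂ) * t) • h t) := by
    intro r hr
    have hr : 0 < r := hr
    rw [hLh r (by simpa using hr), map_neg, hLaplace r (by simpa using hr), smul_neg]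
    congr 1
    rw [← Complex.ofReal_cpow hr.le, Complex.coe_smul, ← Complex.ofReal_inv, Complex.coe_smul, smul_smul,
      smul_smul]
    congr 1
    rw [Real.rpow_add hr, Real.rpow_sub hr, Real.rpow_one]
    ring
  rw [setIntegral_congr_fun measurableSet_Ioi e, integral_neg, hF, smul_neg, smul_smul, ← neg_smul]
  congr 1
  have hs : 0 < Real.sin (π * σ) := by
    apply Real.sin_pos_of_pos_of_lt_pi <;> nlinarith [Real.pi_pos]
  have hrefl := Real.Gamma_mul_Gamma_one_sub σ
  have h1 : 0 < Real.Gamma σ := Real.Gamma_pos_of_pos hσ0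
  have h2 : 0 < Real.Gamma (1 - σ) := Real.Gamma_pos_of_pos (by linarith)
  rw [add_comm 1 σ, Real.Gamma_add_one hσ0.ne']
  have hpi := Real.pi_pos
  have h3 : Real.sin (π * σ) / π = 1 / (Real.Gamma σ * Real.Gamma (1 - σ)) := by
    rw [hrefl, one_div_div]
  rw [h3]
  field_simp
end

section
/- Let (T(t))_{t≥0} be a uniformly bounded C₀-semigroup on a Banach space X with generator A, 0 < σ < 1, and f ∈ D(A). Define u(y) = (y^{2σ}/(4^σ Γ(σ))) ∫₀^∞ e^{-y²/(4t)} t^{-1-σ} T(t)f dt. Then lim_{y→0⁺} (u(y) - f)/y^{2σ} = c_σ (-A)^σ f, where c_σ = 4^{-σ}Γ(-σ)/Γ(σ) with Γ(-σ) = -Γ(1-σ)/σ, and (-A)^σ f = (sin(πσ)/π) ∫₀^∞ λ^{σ-1}(λ-A)^{-1}(-Af) dλ. -/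
open Real MeasureTheory Set Filter Topology

lemma invGamma_aux (c σ : ℝ) (hc : 0 < c) (hσ : 0 < σ) :
    IntegrableOn (fun t : ℝ => Real.exp (-c / t) * t ^ (-1 - σ)) (Ioi 0) ∧
    ∫ t in Ioi (0:ℝ), Real.exp (-c / t) * t ^ (-1 - σ) = c ^ (-σ) * Real.Gamma σ := by
  have key : ∀ t ∈ Ioi (0:ℝ), (|(-1:ℝ)| * t ^ ((-1:ℝ) - 1)) •
      ((t ^ (-1:ℝ)) ^ (σ - 1) * Real.exp (-(c * t ^ (-1:ℝ)))) =
      Real.exp (-c / t) * t ^ (-1 - σ) := by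
    intro t ht
    have ht : 0 < t := ht
    rw [← Real.rpow_mul ht.le, smul_eq_mul, abs_neg, abs_one, one_mul, ← mul_assoc,
      ← Real.rpow_add ht, Real.rpow_neg_one, mul_comm]
    congr 2 <;> ring
  have hI : IntegrableOn (fun s : ℝ => s ^ (σ - 1) * Real.exp (-(c * s))) (Ioi 0) := by
    have := integrableOn_rpow_mul_exp_neg_mul_rpow (p := 1) (s := σ - 1) (b := c)
      (by linarith) one_pos hc
    simpa using this
  constructor
  · have := (integrableOn_Ioi_comp_rpow_iff
      (fun s : ℝ => s ^ (σ - 1) * Real.exp (-(c * s))) (p := -1) (by norm_num)).2 hI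
    exact this.congr_fun key measurableSet_Ioi
  · have := integral_comp_rpow_Ioi
      (fun s : ℝ => s ^ (σ - 1) * Real.exp (-(c * s))) (p := -1) (by norm_num)
    rw [setIntegral_congr_fun measurableSet_Ioi key,
      Real.integral_rpow_mul_exp_neg_mul_Ioi hσ hc] at this
    rw [this, one_div, Real.inv_rpow hc.le, Real.rpow_neg hc.le]

lemma integrable_aux {X : Type*} [NormedAddCommGroup X] [NormedSpace ℝ X]
    (G : ℝ → X) (C σ : ℝ) (hσ0 : 0 < σ) (hσ1 : σ < 1)
    (hG : ContinuousOn G (Ioi 0)) (h1 : ∀ t, 0 < t → ‖G t‖ ≤ C * t)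
    (h2 : ∀ t, 0 < t → ‖G t‖ ≤ C) :
    IntegrableOn (fun t : ℝ => t ^ (-1 - σ) • G t) (Ioi 0) := by
  have hm : AEStronglyMeasurable (fun t : ℝ => t ^ (-1 - σ) • G t)
      (volume.restrict (Ioi 0)) := by
    refine ContinuousOn.aestronglyMeasurable (ContinuousOn.smul ?_ hG) measurableSet_Ioi
    exact fun t ht => (Real.continuousAt_rpow_const _ _
      (Or.inl (ne_of_gt ht))).continuousWithinAt
  rw [← Ioc_union_Ioi_eq_Ioi (zero_le_one (α := ℝ))]
  refine IntegrableOn.union ?_ ?_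
  · have hi : IntegrableOn (fun t : ℝ => C * t ^ (-σ)) (Ioc 0 1) := by
      have := intervalIntegral.intervalIntegrable_rpow' (a := 0) (b := 1) (r := -σ) (by linarith)
      rw [intervalIntegrable_iff_integrableOn_Ioc_of_le zero_le_one] at this
      exact this.const_mul C
    refine Integrable.mono' hi (hm.mono_set Ioc_subset_Ioi_self) ?_
    refine (ae_restrict_mem measurableSet_Ioc).mono fun t ht => ?_
    have ht0 : 0 < t := ht.1
    rw [norm_smul, Real.norm_of_nonneg (Real.rpow_nonneg ht0.le _)]
    calc t ^ (-1 - σ) * ‖G t‖ ≤ t ^ (-1 - σ) * (C * t) := by gcongr; exact h1 t ht0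
      _ = C * (t ^ (-1 - σ) * t ^ (1:ℝ)) := by rw [Real.rpow_one]; ring
      _ = _ := by rw [← Real.rpow_add ht0]; congr 2; ring
  · have hi : IntegrableOn (fun t : ℝ => C * t ^ (-1 - σ)) (Ioi 1) :=
      (integrableOn_Ioi_rpow_of_lt (by linarith) one_pos).const_mul C
    refine Integrable.mono' hi (hm.mono_set (Ioi_subset_Ioi zero_le_one)) ?_
    refine (ae_restrict_mem measurableSet_Ioi).mono fun t ht => ?_
    have ht0 : 0 < t := lt_trans one_pos ht
    rw [norm_smul, Real.norm_of_nonneg (Real.rpow_nonneg ht0.le _), mul_comm]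
    gcongr
    exact h2 t ht0

lemma fubini_aux {X : Type*} [NormedAddCommGroup X] [NormedSpace ℝ X] [CompleteSpace X]
    (G : ℝ → X) (σ : ℝ) (hσ0 : 0 < σ)
    (hG : ContinuousOn G (Ioi 0))
    (hI : IntegrableOn (fun t : ℝ => t ^ (-1 - σ) • G t) (Ioi 0)) :
    ∫ lam in Ioi (0:ℝ), lam ^ σ • ∫ t in Ioi (0:ℝ), Real.exp (-lam * t) • G t =
      Real.Gamma (σ + 1) • ∫ t in Ioi (0:ℝ), t ^ (-1 - σ) • G t := by
  have hint : ∀ t ∈ Ioi (0:ℝ), ∫ lam in Ioi (0:ℝ), lam ^ σ * Real.exp (-lam * t) =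
      Real.Gamma (σ + 1) * t ^ (-1 - σ) := by
    intro t ht
    have ht : 0 < t := ht
    have := Real.integral_rpow_mul_exp_neg_mul_Ioi (a := σ + 1) (r := t) (by linarith) ht
    rw [one_div, Real.inv_rpow ht.le, ← Real.rpow_neg ht.le] at this
    rw [mul_comm, show -1 - σ = -(σ + 1) by ring, ← this]
    simp only [add_sub_cancel_right, neg_mul, mul_comm t]
  have hii : ∀ t ∈ Ioi (0:ℝ), IntegrableOn (fun lam : ℝ => lam ^ σ * Real.exp (-lam * t))
      (Ioi 0) := by
    intro t ht
    have := integrableOn_rpow_mul_exp_neg_mul_rpow (p := 1) (s := σ) (b := t)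
      (by linarith) one_pos ht
    simpa [mul_comm t] using this
  have hprod : Integrable (Function.uncurry
      fun lam t : ℝ => (lam ^ σ * Real.exp (-lam * t)) • G t)
      ((volume.restrict (Ioi (0:ℝ))).prod (volume.restrict (Ioi (0:ℝ)))) := by
    have hm : AEStronglyMeasurable (Function.uncurry
      fun lam t : ℝ => (lam ^ σ * Real.exp (-lam * t)) • G t)
      ((volume.restrict (Ioi (0:ℝ))).prod (volume.restrict (Ioi (0:ℝ)))) := by
      rw [Measure.prod_restrict]
      refine ContinuousOn.aestronglyMeasurable ?_ (measurableSet_Ioi.prod measurableSet_Ioi)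
      refine ContinuousOn.smul (ContinuousOn.mul ?_ (by fun_prop)) ?_
      · exact continuousOn_fst.rpow_const fun x hx => Or.inr hσ0.le
      · exact hG.comp continuousOn_snd fun x hx => hx.2
    rw [integrable_prod_iff' hm]
    constructor
    · refine (ae_restrict_mem measurableSet_Ioi).mono fun t ht => ?_
      exact (hii t ht).smul_const (G t)
    · have : IntegrableOn (fun t : ℝ => Real.Gamma (σ + 1) * ‖t ^ (-1 - σ) • G t‖) (Ioi 0) :=
        hI.norm.const_mul _
      refine this.congr_fun (fun t ht => ?_) measurableSet_Ioi
      have ht0 : 0 < t := ht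
      simp only [Function.uncurry_apply_pair]
      rw [norm_smul, Real.norm_of_nonneg (Real.rpow_nonneg ht0.le _), ← mul_assoc, ← hint t ht,
        ← integral_mul_const]
      refine setIntegral_congr_fun measurableSet_Ioi fun lam hl => ?_
      have hl0 : 0 < lam := hl
      rw [norm_smul, Real.norm_of_nonneg (by positivity)]
  have := integral_integral_swap hprod
  calc _ = ∫ lam in Ioi (0:ℝ), ∫ t in Ioi (0:ℝ), (lam ^ σ * Real.exp (-lam * t)) • G t := by
        simp_rw [mul_smul, integral_smul]
    _ = _ := this
    _ = ∫ t in Ioi (0:ℝ), Real.Gamma (σ + 1) • t ^ (-1 - σ) • G t := by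
        refine setIntegral_congr_fun measurableSet_Ioi fun t ht => ?_
        rw [integral_smul_const, hint t ht, mul_smul]
    _ = _ := integral_smul _ _

lemma resolvent_aux {X : Type*} [NormedAddCommGroup X] [NormedSpace ℝ X] [CompleteSpace X]
    (T : ℝ → X →L[ℝ] X) (M : ℝ)
    (hT0 : T 0 = ContinuousLinearMap.id ℝ X)
    (hTsemi : ∀ s t : ℝ, 0 ≤ s → 0 ≤ t → T (s + t) = (T s).comp (T t))
    (hTbound : ∀ t : ℝ, 0 ≤ t → ‖T t‖ ≤ M)
    (hTcont : ∀ g : X, ContinuousOn (fun t => T t g) (Ici (0:ℝ)))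
    (f Af : X)
    (hgen : Tendsto (fun t : ℝ => t⁻¹ • (T t f - f)) (𝓝[>] (0:ℝ)) (𝓝 Af))
    (lam : ℝ) (hl : 0 < lam) :
    ∫ t in Ioi (0:ℝ), Real.exp (-lam * t) • T t (-Af) =
      lam • ∫ t in Ioi (0:ℝ), Real.exp (-lam * t) • (f - T t f) := by
  have hTg : ∀ g : X, ∀ t, 0 ≤ t → ‖T t g‖ ≤ M * ‖g‖ := fun g t ht =>
    (T t).le_of_opNorm_le (hTbound t ht) g
  have hintg : ∀ (H : ℝ → X) (C : ℝ), ContinuousOn H (Ici 0) → (∀ t, 0 ≤ t → ‖H t‖ ≤ C) →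
      IntegrableOn (fun t => Real.exp (-lam * t) • H t) (Ioi 0) := by
    intro H C hH hC
    have he : IntegrableOn (fun t : ℝ => Real.exp (-lam * t) * C) (Ioi 0) :=
      (integrableOn_exp_mul_Ioi (by linarith) 0).mul_const C
    refine Integrable.mono' he (ContinuousOn.aestronglyMeasurable
      (ContinuousOn.smul (by fun_prop) (hH.mono Ioi_subset_Ici_self)) measurableSet_Ioi) ?_
    refine (ae_restrict_mem measurableSet_Ioi).mono fun t ht => ?_
    rw [norm_smul, Real.norm_of_nonneg (Real.exp_pos _).le]
    gcongr
    exact hC t (le_of_lt ht)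
  have hGc : ContinuousOn (fun t => f - T t f) (Ici 0) := continuousOn_const.sub (hTcont f)
  have hGb : ∀ t, 0 ≤ t → ‖f - T t f‖ ≤ ‖f‖ + M * ‖f‖ := fun t ht =>
    (norm_sub_le _ _).trans (by gcongr; exact hTg f t ht)
  have i1 := hintg _ _ (hTcont (-Af)) (hTg (-Af))
  have i2 := hintg _ _ hGc hGb
  have i3 : IntegrableOn (fun t => Real.exp (-lam * t) • T t (-Af) -
      lam • Real.exp (-lam * t) • (f - T t f)) (Ioi 0) := i1.sub (i2.smul lam)
  have hderiv : ∀ t, 0 ≤ t → HasDerivWithinAt (fun t => T t f) (T t Af) (Ioi t) t := by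
    intro t ht
    rw [hasDerivWithinAt_iff_tendsto_slope' (by simp)]
    have h1 : Tendsto (fun h : ℝ => T t (h⁻¹ • (T h f - f))) (𝓝[>] (0:ℝ)) (𝓝 (T t Af)) :=
      ((T t).continuous.tendsto _).comp hgen
    have h2 : Tendsto (fun s : ℝ => s - t) (𝓝[>] t) (𝓝[>] 0) := by
      refine tendsto_nhdsWithin_iff.2 ⟨?_, ?_⟩
      · have : Tendsto (fun s : ℝ => s - t) (𝓝 t) (𝓝 (t - t)) :=
          (continuous_id.sub continuous_const).tendsto t
        rw [sub_self] at this
        exact this.mono_left nhdsWithin_le_nhds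
      · filter_upwards [self_mem_nhdsWithin] with s hs
        have hs1 : t < s := hs
        exact sub_pos.2 hs1
    refine (h1.comp h2).congr' ?_
    filter_upwards [self_mem_nhdsWithin] with s hs
    have hs1 : t < s := hs
    have hs' : 0 ≤ s - t := (sub_pos.2 hs1).le
    have := hTsemi t (s - t) ht hs'
    rw [add_sub_cancel] at this
    simp [slope_def_module, this]
  have hcF : ContinuousOn (fun t => Real.exp (-lam * t) • (f - T t f)) (Ici 0) :=
    ContinuousOn.smul (by fun_prop) hGc
  have hF : ∀ R, 0 ≤ R → ∫ t in (0:ℝ)..R, (Real.exp (-lam * t) • T t (-Af) -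
      lam • Real.exp (-lam * t) • (f - T t f)) = Real.exp (-lam * R) • (f - T R f) := by
    intro R hR
    rw [intervalIntegral.integral_eq_sub_of_hasDeriv_right
      (f := fun t => Real.exp (-lam * t) • (f - T t f))]
    · simp [hT0]
    · rw [uIcc_of_le hR]; exact hcF.mono Icc_subset_Ici_self
    · intro x hx
      rw [min_eq_left hR] at hx
      have hx0 : 0 < x := hx.1
      have he : HasDerivWithinAt (fun t : ℝ => Real.exp (-lam * t))
          (Real.exp (-lam * x) * (-lam * 1)) (Ioi x) x :=
        (((hasDerivAt_id x).const_mul (-lam)).exp).hasDerivWithinAt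
      have := he.smul ((hderiv x hx0.le).const_sub f)
      refine this.congr_deriv ?_
      rw [map_neg]
      module
    · rw [intervalIntegrable_iff_integrableOn_Ioc_of_le hR]
      exact i3.mono_set Ioc_subset_Ioi_self
  have hlim : Tendsto (fun R : ℝ => Real.exp (-lam * R) • (f - T R f)) atTop (𝓝 0) := by
    have hz : Tendsto (fun R : ℝ => Real.exp (-lam * R) * (‖f‖ + M * ‖f‖)) atTop (𝓝 0) := by
      have : Tendsto (fun R : ℝ => Real.exp (-lam * R)) atTop (𝓝 0) :=
        Real.tendsto_exp_atBot.comp (tendsto_id.const_mul_atTop_of_neg (by linarith))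
      simpa using this.mul_const (‖f‖ + M * ‖f‖)
    refine squeeze_zero_norm' ?_ hz
    filter_upwards [eventually_ge_atTop 0] with R hR
    rw [norm_smul, Real.norm_of_nonneg (Real.exp_pos _).le]
    gcongr
    exact hGb R hR
  have hl2 := intervalIntegral_tendsto_integral_Ioi 0 i3 tendsto_id
  have hl3 := hl2.congr' (by
    filter_upwards [eventually_ge_atTop 0] with R hR
    exact hF R hR)
  have h0 := tendsto_nhds_unique hl3 hlim
  have i4 : IntegrableOn (fun t => lam • Real.exp (-lam * t) • (f - T t f)) (Ioi 0) :=
    i2.smul lam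
  rw [integral_sub i1 i4, sub_eq_zero] at h0
  rw [h0]
  exact integral_smul _ _


theorem extension_neumann_limit_fractional_power
    {X : Type*} [NormedAddCommGroup X] [NormedSpace ℝ X] [CompleteSpace X]
    (T : ℝ → X →L[ℝ] X) (M : ℝ)
    (hT0 : T 0 = ContinuousLinearMap.id ℝ X)
    (hTsemi : ∀ s t : ℝ, 0 ≤ s → 0 ≤ t → T (s + t) = (T s).comp (T t))
    (hTbound : ∀ t : ℝ, 0 ≤ t → ‖T t‖ ≤ M)
    (hTcont : ∀ g : X, ContinuousOn (fun t => T t g) (Ici (0:ℝ)))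
    (σ : ℝ) (hσ0 : 0 < σ) (hσ1 : σ < 1)
    (f Af : X)
    -- f belongs to the domain of the generator A, with A f = Af
    (hgen : Tendsto (fun t : ℝ => t⁻¹ • (T t f - f)) (𝓝[>] (0:ℝ)) (𝓝 Af))
    (u : ℝ → X)
    (hu : ∀ y : ℝ, u y =
      (y ^ (2 * σ) / (4 ^ σ * Real.Gamma σ)) •
        ∫ t in Ioi (0:ℝ), (Real.exp (-y ^ 2 / (4 * t)) * t ^ (-1 - σ)) • T t f)
    -- Balakrishnan fractional power (-A)^σ f, with (λ - A)⁻¹ g = ∫₀^∞ e^{-λ t} T(t) g dt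
    (Aσf : X)
    (hAσf : Aσf = (Real.sin (π * σ) / π) •
      ∫ lam in Ioi (0:ℝ),
        lam ^ (σ - 1) • ∫ t in Ioi (0:ℝ), Real.exp (-lam * t) • T t (-Af)) :
    Tendsto (fun y : ℝ => (y ^ (2 * σ))⁻¹ • (u y - f)) (𝓝[>] (0:ℝ))
      (𝓝 ((4 ^ (-σ) * (-Real.Gamma (1 - σ) / σ) / Real.Gamma σ) • Aσf)) := by

  have hM0 : 0 ≤ M := (norm_nonneg _).trans (hTbound 0 le_rfl)
  have hTg : ∀ g : X, ∀ t, 0 ≤ t → ‖T t g‖ ≤ M * ‖g‖ := fun g t ht =>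
    (T t).le_of_opNorm_le (hTbound t ht) g
  set K : ℝ := ‖f‖ + M * ‖f‖ with hK
  have hK0 : 0 ≤ K := by positivity
  have hGb : ∀ t, 0 ≤ t → ‖f - T t f‖ ≤ K := fun t ht =>
    (norm_sub_le _ _).trans (by rw [hK]; gcongr; exact hTg f t ht)
  have hGc : ContinuousOn (fun t => f - T t f) (Ioi 0) :=
    (continuousOn_const.sub (hTcont f)).mono Ioi_subset_Ici_self
  obtain ⟨C, hC1, hC2⟩ : ∃ C : ℝ, (∀ t, 0 < t → ‖f - T t f‖ ≤ C * t) ∧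
      ∀ t, 0 < t → ‖f - T t f‖ ≤ C := by
    have hev : ∀ᶠ t in 𝓝[>] (0:ℝ), ‖t⁻¹ • (T t f - f)‖ < ‖Af‖ + 1 :=
      hgen.norm.eventually_lt_const (by linarith)
    obtain ⟨δ, hδ, hδ'⟩ := mem_nhdsGT_iff_exists_Ioo_subset.1 hev
    have hδ0 : 0 < δ := hδ
    refine ⟨max (max K (K / δ)) (‖Af‖ + 1), fun t ht => ?_, fun t ht => ?_⟩
    · rcases lt_or_ge t δ with h | h
      · have h3 : ‖t⁻¹ • (T t f - f)‖ < ‖Af‖ + 1 := hδ' ⟨ht, h⟩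
        rw [norm_smul, norm_inv, Real.norm_of_nonneg ht.le, norm_sub_rev,
          inv_mul_lt_iff₀ ht] at h3
        rw [mul_comm]
        exact h3.le.trans (by gcongr; exact le_max_right _ _)
      · calc ‖f - T t f‖ ≤ K := hGb t ht.le
          _ = K / δ * δ := by field_simp
          _ ≤ K / δ * t := by gcongr
          _ ≤ _ := by gcongr; exact (le_max_right _ _).trans (le_max_left _ _)
    · exact (hGb t ht.le).trans ((le_max_left _ _).trans (le_max_left _ _))
  have hI := integrable_aux (fun t => f - T t f) C σ hσ0 hσ1 hGc hC1 hC2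
  set J : X := ∫ t in Ioi (0:ℝ), t ^ (-1 - σ) • (f - T t f) with hJ
  have hA : Aσf = (σ / Real.Gamma (1 - σ)) • J := by
    have hg1 : 0 < Real.Gamma σ := Real.Gamma_pos_of_pos hσ0
    have hg2 : 0 < Real.Gamma (1 - σ) := Real.Gamma_pos_of_pos (by linarith)
    have e1 : ∫ lam in Ioi (0:ℝ),
        lam ^ (σ - 1) • ∫ t in Ioi (0:ℝ), Real.exp (-lam * t) • T t (-Af) =
        Real.Gamma (σ + 1) • J := by
      rw [hJ, ← fubini_aux (fun t => f - T t f) σ hσ0 hGc hI]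
      refine setIntegral_congr_fun measurableSet_Ioi fun lam hl => ?_
      have hl0 : 0 < lam := hl
      rw [resolvent_aux T M hT0 hTsemi hTbound hTcont f Af hgen lam hl0, smul_smul]
      congr 1
      rw [← Real.rpow_add_one hl0.ne', sub_add_cancel]
    rw [hAσf, e1, smul_smul, Real.Gamma_add_one hσ0.ne']
    congr 1
    have := Real.Gamma_mul_Gamma_one_sub σ
    have e2 : Real.sin (π * σ) / π = (Real.Gamma σ * Real.Gamma (1 - σ))⁻¹ := by
      rw [this, inv_div]
    rw [e2]
    field_simp
  have hlim : Tendsto (fun y : ℝ => ∫ t in Ioi (0:ℝ),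
      Real.exp (-y ^ 2 / (4 * t)) • t ^ (-1 - σ) • (f - T t f)) (𝓝[>] 0) (𝓝 J) := by
    refine tendsto_integral_filter_of_dominated_convergence
      (fun t => ‖t ^ (-1 - σ) • (f - T t f)‖) ?_ ?_ hI.norm ?_
    · refine Eventually.of_forall fun y => ?_
      refine AEStronglyMeasurable.smul ?_ hI.aestronglyMeasurable
      exact (Measurable.aestronglyMeasurable (by fun_prop))
    · refine Eventually.of_forall fun y => ?_
      refine (ae_restrict_mem measurableSet_Ioi).mono fun t ht => ?_
      have ht0 : 0 < t := ht
      rw [norm_smul _ (t ^ (-1 - σ) • (f - T t f)), Real.norm_of_nonneg (Real.exp_pos _).le]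
      refine mul_le_of_le_one_left (norm_nonneg _) (Real.exp_le_one_iff.2 ?_)
      rw [neg_div]
      have : 0 ≤ y ^ 2 / (4 * t) := by positivity
      linarith
    · refine Eventually.of_forall fun t => ?_
      have : Tendsto (fun y : ℝ => Real.exp (-y ^ 2 / (4 * t))) (𝓝 0) (𝓝 1) := by
        have hc : Continuous (fun y : ℝ => Real.exp (-y ^ 2 / (4 * t))) := by fun_prop
        simpa using hc.tendsto 0
      simpa using (this.mono_left nhdsWithin_le_nhds).smul_const (t ^ (-1 - σ) • (f - T t f))
  have hfin := hlim.const_smul (-(4 ^ σ * Real.Gamma σ)⁻¹)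
  have hg1 : 0 < Real.Gamma σ := Real.Gamma_pos_of_pos hσ0
  have hg2 : 0 < Real.Gamma (1 - σ) := Real.Gamma_pos_of_pos (by linarith)
  have h4 : (0:ℝ) < 4 ^ σ := Real.rpow_pos_of_pos (by norm_num) _
  have hcst : (4 ^ (-σ) * (-Real.Gamma (1 - σ) / σ) / Real.Gamma σ) • Aσf =
      (-(4 ^ σ * Real.Gamma σ)⁻¹) • J := by
    rw [hA, smul_smul, Real.rpow_neg (by norm_num)]
    congr 1
    field_simp
  rw [hcst]
  refine hfin.congr' ?_
  filter_upwards [self_mem_nhdsWithin] with y hy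
  have hy0 : 0 < y := hy
  have hyp : 0 < y ^ (2 * σ) := Real.rpow_pos_of_pos hy0 _
  obtain ⟨q1, q2⟩ := invGamma_aux (y ^ 2 / 4) σ (by positivity) hσ0
  have heq : ∀ t : ℝ, -(y ^ 2 / 4) / t = -y ^ 2 / (4 * t) := by
    intro t; rw [← neg_div, div_div]
  simp only [heq] at q1 q2
  have hpow : (y ^ 2 / 4) ^ (-σ) = 4 ^ σ / y ^ (2 * σ) := by
    rw [Real.rpow_neg (by positivity), Real.div_rpow (by positivity) (by norm_num), inv_div,
      Real.rpow_mul hy0.le]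
    norm_num
  rw [hpow] at q2
  have i1 := q1.smul_const f
  have i2 : IntegrableOn (fun t : ℝ =>
      (Real.exp (-y ^ 2 / (4 * t)) * t ^ (-1 - σ)) • T t f) (Ioi 0) := by
    refine Integrable.mono' (q1.mul_const (M * ‖f‖)) (q1.aestronglyMeasurable.smul
      (((hTcont f).mono Ioi_subset_Ici_self).aestronglyMeasurable measurableSet_Ioi)) ?_
    refine (ae_restrict_mem measurableSet_Ioi).mono fun t ht => ?_
    have ht0 : 0 < t := ht
    rw [norm_smul, Real.norm_of_nonneg (by positivity)]
    gcongr
    exact hTg f t ht0.le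
  have e3 : ∫ t in Ioi (0:ℝ), Real.exp (-y ^ 2 / (4 * t)) • t ^ (-1 - σ) • (f - T t f) =
      (4 ^ σ / y ^ (2 * σ) * Real.Gamma σ) • f -
      ∫ t in Ioi (0:ℝ), (Real.exp (-y ^ 2 / (4 * t)) * t ^ (-1 - σ)) • T t f := by
    rw [← q2, ← integral_smul_const, ← integral_sub i1 i2]
    refine integral_congr_ae (Eventually.of_forall fun t => ?_)
    simp only [smul_smul, smul_sub]
  rw [e3, hu, smul_sub, smul_sub, smul_smul, smul_smul]
  have c1 : -(4 ^ σ * Real.Gamma σ)⁻¹ * (4 ^ σ / y ^ (2 * σ) * Real.Gamma σ) =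
      -(y ^ (2 * σ))⁻¹ := by field_simp
  have c2 : (y ^ (2 * σ))⁻¹ * (y ^ (2 * σ) / (4 ^ σ * Real.Gamma σ)) =
      (4 ^ σ * Real.Gamma σ)⁻¹ := by field_simp
  rw [c1, c2]
  simp only [neg_smul]
  abel
end
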